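/- Let 1 ≤ r ≤ n, let A be a uniformly random matrix in F₂^{r×n}, and let X be the number of r-element subsets S ⊆ [n] such that the columns of A indexed by S form a basis of F₂^r. Then E[X] = p_r·C(n,r) where p_r = ∏_{i=1}^r (1 − 2^{−i}), and Var[X] ≤ 4·((n+r)/(2n))^r·(E[X])². -/

import Mathlib

open Finset

/-- The number of `r`-element subsets `S ⊆ [n]` such that the columns of `A`
indexed by `S` form a basis of `F₂^r` (linearly independent and spanning). -/
noncomputable def basisCount (r n : ℕ) (A : Matrix (Fin r) (Fin n) (ZMod 2)) : ℕ :=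
  Nat.card {S : Finset (Fin n) // S.card = r ∧
    LinearIndependent (ZMod 2) (fun i : S => fun j => A j i.1) ∧
    Submodule.span (ZMod 2) (Set.range fun i : S => fun j => A j i.1) = ⊤}

/-- The number of column families satisfying `P`, as a real number. -/
noncomputable def cnt {r n : ℕ} (P : (Fin n → Fin r → ZMod 2) → Prop) : ℝ :=
  open Classical in ∑ f : Fin n → Fin r → ZMod 2, if P f then (1 : ℝ) else 0

/-- The product `p_d`. -/
noncomputable def pp (d : ℕ) : ℝ := ∏ i ∈ Finset.Icc 1 d, (1 - ((2 : ℝ) ^ i)⁻¹)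

lemma pp_zero : pp 0 = 1 := by simp [pp]

lemma pp_succ (d : ℕ) : pp (d + 1) = pp d * (1 - ((2 : ℝ) ^ (d + 1))⁻¹) := by
  unfold pp
  rw [Finset.prod_Icc_succ_top (by omega)]

lemma cnt_congr {r n : ℕ} {P Q : (Fin n → Fin r → ZMod 2) → Prop} (h : ∀ f, P f ↔ Q f) :
    cnt P = cnt Q := by
  have : P = Q := funext fun f => propext (h f)
  rw [this]

lemma sum_update {r n : ℕ} (a : Fin n) (g : (Fin n → Fin r → ZMod 2) → ℝ) :
    ∑ f : Fin n → Fin r → ZMod 2, ∑ x : Fin r → ZMod 2, g (Function.update f a x)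
      = (∑ f : Fin n → Fin r → ZMod 2, g f) * 2 ^ r := by
  have e : ∑ p : (Fin n → Fin r → ZMod 2) × (Fin r → ZMod 2), g (Function.update p.1 a p.2)
      = ∑ p : (Fin n → Fin r → ZMod 2) × (Fin r → ZMod 2), g p.1 := by
    refine Finset.sum_bij' (fun p _ => (Function.update p.1 a p.2, p.1 a))
      (fun p _ => (Function.update p.1 a p.2, p.1 a)) ?_ ?_ ?_ ?_ ?_ <;> simp
  rw [Fintype.sum_prod_type, Fintype.sum_prod_type] at e
  rw [e, Finset.sum_mul]
  refine Finset.sum_congr rfl fun f _ => ?_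
  simp [mul_comm]

lemma sum_not_span {r n : ℕ} (f : Fin n → Fin r → ZMod 2) (S : Finset (Fin n))
    (h : LinearIndepOn (ZMod 2) f (S : Set (Fin n))) :
    (open Classical in ∑ x : Fin r → ZMod 2,
      if x ∉ Submodule.span (ZMod 2) (f '' (S : Set (Fin n))) then (1 : ℝ) else 0)
      = 2 ^ r - 2 ^ S.card := by
  classical
  set W := Submodule.span (ZMod 2) (f '' (S : Set (Fin n))) with hW
  have hf : Module.finrank (ZMod 2) W = S.card := by
    have := finrank_span_eq_card (R := ZMod 2) h
    rw [hW, Set.image_eq_range]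
    simpa using this
  have hc : Fintype.card W = 2 ^ S.card := by
    rw [Module.card_eq_pow_finrank (K := ZMod 2), hf, ZMod.card]
  have h1 : (∑ x : Fin r → ZMod 2, if x ∈ W then (1 : ℝ) else 0) = 2 ^ S.card := by
    rw [Finset.sum_boole, ← Fintype.card_subtype]
    have : Fintype.card {x // x ∈ W} = 2 ^ S.card := by
      rw [← hc]
    rw [this]; push_cast; rfl
  have h2 : (∑ x : Fin r → ZMod 2, if x ∉ W then (1 : ℝ) else 0)
      + (∑ x : Fin r → ZMod 2, if x ∈ W then (1 : ℝ) else 0) = 2 ^ r := by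
    rw [← Finset.sum_add_distrib]
    have : ∀ x : Fin r → ZMod 2, ((if x ∉ W then (1 : ℝ) else 0) + if x ∈ W then 1 else 0) = 1 := by
      intro x; by_cases hx : x ∈ W <;> simp [hx]
    rw [Finset.sum_congr rfl fun x _ => this x]
    simp
  rw [h1] at h2
  rw [← h2]
  simp

lemma indep_update {r n : ℕ} (f : Fin n → Fin r → ZMod 2) (S : Finset (Fin n)) (a : Fin n)
    (ha : a ∉ S) (x : Fin r → ZMod 2) :
    LinearIndepOn (ZMod 2) (Function.update f a x) (S : Set (Fin n)) ↔
      LinearIndepOn (ZMod 2) f (S : Set (Fin n)) := by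
  have h : Set.EqOn (Function.update f a x) f (S : Set (Fin n)) := by
    intro i hi
    apply Function.update_of_ne
    rintro rfl; exact ha hi
  exact ⟨fun H => H.congr h, fun H => H.congr h.symm⟩

lemma one_step {r n : ℕ} (Q : (Fin n → Fin r → ZMod 2) → Prop) (a : Fin n)
    (hQ : ∀ f x, Q (Function.update f a x) ↔ Q f) (S : Finset (Fin n)) (ha : a ∉ S) :
    cnt (fun f => Q f ∧ LinearIndepOn (ZMod 2) f ((insert a S : Finset (Fin n)) : Set (Fin n)))
        * 2 ^ r
      = cnt (fun f => Q f ∧ LinearIndepOn (ZMod 2) f (S : Set (Fin n))) * (2 ^ r - 2 ^ S.card) := by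
  classical
  unfold cnt
  rw [← sum_update a, Finset.sum_mul]
  refine Finset.sum_congr rfl fun f _ => ?_
  have him : ∀ x, (Function.update f a x) '' (S : Set (Fin n)) = f '' (S : Set (Fin n)) := by
    intro x
    apply Set.image_congr
    intro i hi
    apply Function.update_of_ne
    rintro rfl; exact ha hi
  by_cases h : Q f ∧ LinearIndepOn (ZMod 2) f (S : Set (Fin n))
  · rw [if_pos h, one_mul, ← sum_not_span f S h.2]
    refine Finset.sum_congr rfl fun x _ => ?_
    beta_reduce
    rw [Finset.coe_insert, linearIndepOn_insert (fun H => ha (Finset.mem_coe.1 H)), hQ,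
      indep_update f S a ha, him]
    simp [h.1, h.2]
  · rw [if_neg h, zero_mul]
    refine Finset.sum_eq_zero fun x _ => ?_
    beta_reduce
    rw [Finset.coe_insert, linearIndepOn_insert (fun H => ha (Finset.mem_coe.1 H)), hQ,
      indep_update f S a ha, if_neg]
    tauto

lemma multi_step {r n : ℕ} (Q : (Fin n → Fin r → ZMod 2) → Prop) (D : Finset (Fin n)) :
    (∀ a ∈ D, ∀ f x, Q (Function.update f a x) ↔ Q f) →
    ∀ C : Finset (Fin n), Disjoint C D → C.card + D.card = r →
    cnt (fun f => Q f ∧ LinearIndepOn (ZMod 2) f ((C ∪ D : Finset (Fin n)) : Set (Fin n)))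
      = cnt (fun f => Q f ∧ LinearIndepOn (ZMod 2) f (C : Set (Fin n))) * pp D.card := by
  induction D using Finset.induction_on with
  | empty => intro _ C _ _; simp [pp_zero]
  | insert a D ha ih =>
    intro hQ C hCD hc
    rw [Finset.card_insert_of_notMem ha] at hc ⊢
    rw [Finset.disjoint_insert_right] at hCD
    have h1 := ih (fun b hb => hQ b (Finset.mem_insert_of_mem hb)) (insert a C)
      (by rw [Finset.disjoint_insert_left]; exact ⟨ha, hCD.2⟩)
      (by rw [Finset.card_insert_of_notMem hCD.1]; omega)
    have h2 := one_step Q a (hQ a (Finset.mem_insert_self _ _)) C hCD.1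
    rw [show C ∪ insert a D = insert a C ∪ D by
      rw [Finset.union_insert, Finset.insert_union], h1, pp_succ]
    have h3 : (2 : ℝ) ^ r = 2 ^ C.card * 2 ^ (D.card + 1) := by rw [← pow_add, hc]
    rw [h3] at h2
    have h4 : cnt (fun f => Q f ∧
        LinearIndepOn (ZMod 2) f ((insert a C : Finset (Fin n)) : Set (Fin n)))
        = cnt (fun f => Q f ∧ LinearIndepOn (ZMod 2) f (C : Set (Fin n)))
          * (1 - ((2 : ℝ) ^ (D.card + 1))⁻¹) := by
      have p1 : (2 : ℝ) ^ C.card ≠ 0 := by positivity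
      have p2 : (2 : ℝ) ^ (D.card + 1) ≠ 0 := by positivity
      apply mul_right_cancel₀ (mul_ne_zero p1 p2)
      rw [h2]
      field_simp
    rw [h4]; ring

lemma sum_matrix {r n : ℕ} (g : (Fin n → Fin r → ZMod 2) → ℝ) :
    ∑ A : Matrix (Fin r) (Fin n) (ZMod 2), g (fun i j => A j i)
      = ∑ f : Fin n → Fin r → ZMod 2, g f :=
  Fintype.sum_equiv (Equiv.piComm fun _ _ => ZMod 2) _ _ fun _ => rfl

lemma cnt_true {r n : ℕ} : cnt (fun _ : Fin n → Fin r → ZMod 2 => True)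
    = (Nat.card (Matrix (Fin r) (Fin n) (ZMod 2)) : ℝ) := by
  classical
  have h := sum_matrix (r := r) (n := n) (fun _ => (1 : ℝ))
  simp only [cnt, if_true]
  rw [← h, Nat.card_eq_fintype_card]
  simp

lemma cnt_single {r n : ℕ} (S : Finset (Fin n)) (hS : S.card = r) :
    cnt (fun f : Fin n → Fin r → ZMod 2 => LinearIndepOn (ZMod 2) f (S : Set (Fin n)))
      = (Nat.card (Matrix (Fin r) (Fin n) (ZMod 2)) : ℝ) * pp r := by
  have h := multi_step (r := r) (fun _ => True) S (by simp) ∅ (by simp) (by simpa using hS)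
  rw [hS] at h
  rw [← cnt_true]
  simpa using h

lemma cnt_pair {r n : ℕ} (S T : Finset (Fin n)) (hS : S.card = r) (hT : T.card = r) :
    cnt (fun f : Fin n → Fin r → ZMod 2 => LinearIndepOn (ZMod 2) f (T : Set (Fin n)) ∧
        LinearIndepOn (ZMod 2) f (S : Set (Fin n)))
      = (Nat.card (Matrix (Fin r) (Fin n) (ZMod 2)) : ℝ) * pp r * pp (r - (S ∩ T).card) := by
  have hcard : (S ∩ T).card + (S \ T).card = r := by
    rw [Finset.card_inter_add_card_sdiff, hS]
  have h := multi_step (r := r)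
    (fun f => LinearIndepOn (ZMod 2) f (T : Set (Fin n))) (S \ T)
    (fun a ha f x => indep_update f T a (Finset.mem_sdiff.1 ha).2 x) (S ∩ T)
    (Finset.disjoint_left.2 fun x hx hx' =>
      (Finset.mem_sdiff.1 hx').2 (Finset.mem_inter.1 hx).2) hcard
  rw [show S ∩ T ∪ S \ T = S by ext x; simp; tauto] at h
  rw [h, show (S \ T).card = r - (S ∩ T).card by omega]
  congr 1
  rw [← cnt_single T hT]
  refine cnt_congr fun f => ⟨fun H => H.1, fun H => ⟨H, H.mono ?_⟩⟩
  simp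

lemma basisCount_eq (r n : ℕ) (A : Matrix (Fin r) (Fin n) (ZMod 2)) :
    (basisCount r n A : ℝ) = open Classical in ∑ S ∈ Finset.powersetCard r Finset.univ,
      if LinearIndepOn (ZMod 2) (fun i j => A j i) ((S : Finset (Fin n)) : Set (Fin n))
        then (1 : ℝ) else 0 := by
  classical
  unfold basisCount
  rw [Finset.sum_boole, Nat.card_eq_fintype_card, Fintype.card_subtype]
  congr 2
  ext S
  simp only [Finset.mem_filter, Finset.mem_univ, true_and, Finset.mem_powersetCard,
    Finset.subset_univ]
  refine and_congr_right fun hS => ?_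
  constructor
  · exact fun H => H.1
  · intro H
    refine ⟨H, ?_⟩
    exact LinearIndependent.span_eq_top_of_card_eq_finrank' (b := fun i : S => fun j => A j i.1) H
      (by simp [hS])

lemma sum_first (r n : ℕ) :
    ∑ A : Matrix (Fin r) (Fin n) (ZMod 2), (basisCount r n A : ℝ)
      = (Nat.card (Matrix (Fin r) (Fin n) (ZMod 2)) : ℝ) * (pp r * (n.choose r : ℝ)) := by
  classical
  simp_rw [basisCount_eq]
  rw [sum_matrix (fun f => ∑ S ∈ Finset.powersetCard r Finset.univ,
      if LinearIndepOn (ZMod 2) f ((S : Finset (Fin n)) : Set (Fin n))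
        then (1 : ℝ) else 0), Finset.sum_comm]
  rw [Finset.sum_congr rfl (g := fun _ =>
    (Nat.card (Matrix (Fin r) (Fin n) (ZMod 2)) : ℝ) * pp r)]
  · rw [Finset.sum_const, Finset.card_powersetCard, Finset.card_univ, Fintype.card_fin,
      nsmul_eq_mul]
    ring
  · intro S hS
    rw [← cnt_single S (Finset.mem_powersetCard.1 hS).2]
    unfold cnt
    refine Finset.sum_congr rfl fun f _ => ?_
    congr

lemma sum_second (r n : ℕ) :
    ∑ A : Matrix (Fin r) (Fin n) (ZMod 2), (basisCount r n A : ℝ) ^ 2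
      = (Nat.card (Matrix (Fin r) (Fin n) (ZMod 2)) : ℝ) * (pp r *
        ∑ S ∈ Finset.powersetCard r (Finset.univ : Finset (Fin n)),
          ∑ T ∈ Finset.powersetCard r (Finset.univ : Finset (Fin n)),
            pp (r - (S ∩ T).card)) := by
  classical
  simp_rw [basisCount_eq]
  rw [sum_matrix (fun f => (∑ S ∈ Finset.powersetCard r Finset.univ,
      if LinearIndepOn (ZMod 2) f ((S : Finset (Fin n)) : Set (Fin n))
        then (1 : ℝ) else 0) ^ 2)]
  simp_rw [sq, Finset.sum_mul_sum]
  rw [Finset.sum_comm, Finset.mul_sum, Finset.mul_sum]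
  refine Finset.sum_congr rfl fun S hS => ?_
  rw [Finset.sum_comm, Finset.mul_sum, Finset.mul_sum]
  refine Finset.sum_congr rfl fun T hT => ?_
  rw [← mul_assoc, ← cnt_pair S T (Finset.mem_powersetCard.1 hS).2 (Finset.mem_powersetCard.1 hT).2]
  unfold cnt
  refine Finset.sum_congr rfl fun f _ => ?_
  by_cases h1 : LinearIndepOn (ZMod 2) f (S : Set (Fin n)) <;>
  by_cases h2 : LinearIndepOn (ZMod 2) f (T : Set (Fin n)) <;> simp [h1, h2]

lemma pp_pos (d : ℕ) : 0 < pp d := by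
  induction d with
  | zero => simp [pp_zero]
  | succ d ih =>
    rw [pp_succ]
    refine mul_pos ih (sub_pos.2 (inv_lt_one_of_one_lt₀ (one_lt_pow₀ (by norm_num) (by omega))))

lemma pp_ratio (m k : ℕ) :
    pp m * (1 - ((2 : ℝ) ^ m)⁻¹ + ((2 : ℝ) ^ (m + k))⁻¹) ≤ pp (m + k) := by
  induction k with
  | zero => simp
  | succ k ih =>
    rw [← add_assoc, pp_succ]
    have hm := pp_pos m
    have hx : (0 : ℝ) < ((2 : ℝ) ^ (m + k))⁻¹ := by positivity
    have hy : ((2 : ℝ) ^ (m + k))⁻¹ ≤ ((2 : ℝ) ^ m)⁻¹ := by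
      apply inv_anti₀ (by positivity)
      exact pow_le_pow_right₀ (by norm_num) (by omega)
    have hx1 : ((2 : ℝ) ^ (m + k))⁻¹ ≤ 1 :=
      inv_le_one_of_one_le₀ (one_le_pow₀ (by norm_num))
    rw [show ((2 : ℝ) ^ (m + k + 1))⁻¹ = ((2 : ℝ) ^ (m + k))⁻¹ / 2 by
      rw [pow_succ, mul_inv]; ring]
    set x := ((2 : ℝ) ^ (m + k))⁻¹
    set y := ((2 : ℝ) ^ m)⁻¹
    have : pp m * (1 - y + x) * (1 - x / 2) ≤ pp (m + k) * (1 - x / 2) :=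
      mul_le_mul_of_nonneg_right ih (by linarith)
    refine le_trans ?_ this
    rw [mul_assoc]
    refine mul_le_mul_of_nonneg_left ?_ hm.le
    nlinarith

lemma pp_bound (m k : ℕ) : pp m ≤ pp (m + k) * (1 + 4 * ((2 : ℝ) ^ m)⁻¹) := by
  rcases Nat.eq_zero_or_pos m with rfl | hm
  · rcases Nat.eq_zero_or_pos k with rfl | hk
    · simp [pp_zero]
    · obtain ⟨j, rfl⟩ := Nat.exists_eq_add_of_le hk
      have h := pp_ratio 1 j
      have h0 : (0 : ℝ) < ((2 : ℝ) ^ (1 + j))⁻¹ := by positivity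
      have h1 : pp 1 = 1 / 2 := by norm_num [pp]
      rw [h1] at h
      simp only [Nat.succ_eq_add_one, zero_add, pp_zero]
      norm_num at h ⊢
      nlinarith
  · have h := pp_ratio m k
    have hx : (0 : ℝ) < ((2 : ℝ) ^ (m + k))⁻¹ := by positivity
    have hy0 : (0 : ℝ) < ((2 : ℝ) ^ m)⁻¹ := by positivity
    have hy : ((2 : ℝ) ^ m)⁻¹ ≤ 1 / 2 := by
      rw [one_div]
      apply inv_anti₀ (by norm_num)
      exact le_self_pow₀ (by norm_num) (by omega)
    set x := ((2 : ℝ) ^ (m + k))⁻¹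
    set y := ((2 : ℝ) ^ m)⁻¹
    have hp := pp_pos m
    have h3 : pp m * (1 - y) * (1 + 4 * y) ≤ pp (m + k) * (1 + 4 * y) := by
      refine mul_le_mul_of_nonneg_right (le_trans ?_ h) (by linarith)
      exact mul_le_mul_of_nonneg_left (by linarith) hp.le
    refine le_trans ?_ h3
    rw [mul_assoc]
    nth_rewrite 1 [← mul_one (pp m)]
    exact mul_le_mul_of_nonneg_left (by nlinarith) hp.le

lemma choose_bound (n r j : ℕ) (hr : r ≤ n) (hn : 0 < n) (hj : j ≤ r) :
    ((n - j).choose (r - j) : ℝ) ≤ (n.choose r : ℝ) * ((r : ℝ) / n) ^ j := by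
  induction j with
  | zero => simp
  | succ j ih =>
    have ih := ih (by omega)
    obtain ⟨a, ha⟩ : ∃ a, n - j = a + 1 := ⟨n - j - 1, by omega⟩
    obtain ⟨b, hb⟩ : ∃ b, r - j = b + 1 := ⟨r - j - 1, by omega⟩
    have h := Nat.add_one_mul_choose_eq a b
    rw [show n - (j + 1) = a by omega, show r - (j + 1) = b by omega]
    rw [ha, hb] at ih
    have h' : ((a : ℝ) + 1) * (a.choose b : ℝ) = ((a + 1).choose (b + 1) : ℝ) * (b + 1) := by
      exact_mod_cast h
    have ha' : (n : ℝ) = a + 1 + j := by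
      have : n = a + 1 + j := by omega
      exact_mod_cast this
    have hb' : (r : ℝ) = b + 1 + j := by
      have : r = b + 1 + j := by omega
      exact_mod_cast this
    have hab : (b : ℝ) ≤ a := by
      have : b ≤ a := by omega
      exact_mod_cast this
    have h5 : (a.choose b : ℝ) ≤ ((a + 1).choose (b + 1) : ℝ) * ((r : ℝ) / n) := by
      have : (a.choose b : ℝ) = ((a + 1).choose (b + 1) : ℝ) * (((b : ℝ) + 1) / (a + 1)) := by
        field_simp
        linarith
      rw [this]
      refine mul_le_mul_of_nonneg_left ?_ (by positivity)
      rw [ha', hb', div_le_div_iff₀ (by positivity) (by positivity)]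
      have : (0 : ℝ) ≤ j := by positivity
      nlinarith
    refine h5.trans ?_
    rw [pow_succ, ← mul_assoc]
    exact mul_le_mul_of_nonneg_right ih (by positivity)

lemma superset_bound (n r : ℕ) (hr : r ≤ n) (hn : 0 < n) (J : Finset (Fin n)) (hJ : J.card ≤ r) :
    (((Finset.powersetCard r (Finset.univ : Finset (Fin n))).filter (fun T => J ⊆ T)).card : ℝ)
      ≤ (n.choose r : ℝ) * ((r : ℝ) / n) ^ J.card := by
  refine le_trans ?_ (choose_bound n r J.card hr hn hJ)
  have h : ((Finset.powersetCard r (Finset.univ : Finset (Fin n))).filter (fun T => J ⊆ T)).card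
      ≤ (Finset.powersetCard (r - J.card) (Finset.univ \ J)).card := by
    refine Finset.card_le_card_of_injOn (fun T => T \ J) ?_ ?_
    · intro T hT
      simp only [Finset.coe_filter, Set.mem_ofPred_eq, Finset.mem_powersetCard] at hT
      simp only [Finset.mem_coe, Finset.mem_powersetCard]
      refine ⟨Finset.sdiff_subset_sdiff (Finset.subset_univ _) subset_rfl, ?_⟩
      rw [Finset.card_sdiff_of_subset hT.2, hT.1.2]
    · intro T hT U hU hTU
      simp only [Finset.coe_filter, Set.mem_ofPred_eq] at hT hU
      simp only at hTU
      rw [← Finset.sdiff_union_of_subset hT.2, hTU, Finset.sdiff_union_of_subset hU.2]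
  rw [Finset.card_powersetCard, Finset.card_sdiff_of_subset (Finset.subset_univ _),
    Finset.card_univ, Fintype.card_fin] at h
  exact_mod_cast h

lemma overlap_bound (n r : ℕ) (hr : r ≤ n) (hn : 0 < n) (S : Finset (Fin n)) (hS : S.card = r) :
    ∑ T ∈ Finset.powersetCard r (Finset.univ : Finset (Fin n)), (2 : ℝ) ^ (S ∩ T).card
      ≤ (n.choose r : ℝ) * (1 + (r : ℝ) / n) ^ r := by
  have h1 : ∀ T : Finset (Fin n), (2 : ℝ) ^ (S ∩ T).card
      = ∑ J ∈ S.powerset, if J ⊆ T then (1 : ℝ) else 0 := by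
    intro T
    rw [Finset.sum_boole]
    rw [show S.powerset.filter (fun J => J ⊆ T) = (S ∩ T).powerset by
      ext J; rw [Finset.mem_filter, Finset.mem_powerset, Finset.mem_powerset,
        Finset.subset_inter_iff], Finset.card_powerset]
    push_cast; rfl
  simp_rw [h1]
  rw [Finset.sum_comm]
  have h2 : (1 + (r : ℝ) / n) ^ r = ∑ J ∈ S.powerset, ((r : ℝ) / n) ^ J.card := by
    have := Finset.prod_one_add (f := fun _ : Fin n => (r : ℝ) / n) S
    simpa only [Finset.prod_const, hS] using this
  rw [h2, Finset.mul_sum]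
  refine Finset.sum_le_sum fun J hJ => ?_
  rw [Finset.sum_boole]
  exact superset_bound n r hr hn J (hS ▸ Finset.card_le_card (Finset.mem_powerset.1 hJ))

lemma double_bound (n r : ℕ) (hr : r ≤ n) (hn : 0 < n) :
    ∑ S ∈ Finset.powersetCard r (Finset.univ : Finset (Fin n)),
      ∑ T ∈ Finset.powersetCard r (Finset.univ : Finset (Fin n)), pp (r - (S ∩ T).card)
      ≤ pp r * ((n.choose r : ℝ) ^ 2 * (1 + 4 * (((n : ℝ) + r) / (2 * n)) ^ r)) := by
  have key : ∀ S ∈ Finset.powersetCard r (Finset.univ : Finset (Fin n)),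
      ∑ T ∈ Finset.powersetCard r (Finset.univ : Finset (Fin n)), pp (r - (S ∩ T).card)
      ≤ pp r * ((n.choose r : ℝ) * (1 + 4 * (((n : ℝ) + r) / (2 * n)) ^ r)) := by
    intro S hS
    have hS := (Finset.mem_powersetCard.1 hS).2
    have hle : ∀ T ∈ Finset.powersetCard r (Finset.univ : Finset (Fin n)),
        pp (r - (S ∩ T).card) ≤ pp r + pp r * (4 * ((2 : ℝ) ^ r)⁻¹) * (2 : ℝ) ^ (S ∩ T).card := by
      intro T _
      have hk : (S ∩ T).card ≤ r := hS ▸ Finset.card_le_card Finset.inter_subset_left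
      obtain ⟨m, hm⟩ := Nat.exists_eq_add_of_le hk
      have := pp_bound m (S ∩ T).card
      rw [show r - (S ∩ T).card = m by omega]
      refine this.trans (le_of_eq ?_)
      rw [show m + (S ∩ T).card = r by omega]
      have h2 : (2 : ℝ) ^ r = 2 ^ (S ∩ T).card * 2 ^ m := by rw [← pow_add, ← hm]
      rw [h2]
      field_simp
    refine (Finset.sum_le_sum hle).trans ?_
    rw [Finset.sum_add_distrib, ← Finset.mul_sum, Finset.sum_const, Finset.card_powersetCard,
      Finset.card_univ, Fintype.card_fin, nsmul_eq_mul]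
    have h3 := overlap_bound n r hr hn S hS
    have h4 : (((n : ℝ) + r) / (2 * n)) ^ r = ((2 : ℝ) ^ r)⁻¹ * (1 + (r : ℝ) / n) ^ r := by
      rw [← inv_pow, ← mul_pow]
      congr 1
      have : (n : ℝ) ≠ 0 := by positivity
      field_simp
    rw [h4]
    have h5 : (0 : ℝ) ≤ pp r * (4 * ((2 : ℝ) ^ r)⁻¹) := by
      have := pp_pos r
      positivity
    have h6 := mul_le_mul_of_nonneg_left h3 h5
    refine (add_le_add_right h6 _).trans (le_of_eq ?_)
    ring
  refine (Finset.sum_le_sum key).trans (le_of_eq ?_)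
  rw [Finset.sum_const, Finset.card_powersetCard, Finset.card_univ, Fintype.card_fin, nsmul_eq_mul]
  ring

/-- Let `1 ≤ r ≤ n`, let `A` be a uniformly random matrix in `F₂^{r×n}`, and
let `X` count the `r`-element column subsets forming a basis of `F₂^r`. Then
`E[X] = p_r·C(n,r)` with `p_r = ∏_{i=1}^r (1 − 2^{−i})`, and
`Var[X] ≤ 4·((n+r)/(2n))^r·E[X]²`. -/
theorem random_matrix_basis_count (r n : ℕ) (h1 : 1 ≤ r) (h2 : r ≤ n) :
    (∑ A : Matrix (Fin r) (Fin n) (ZMod 2), (basisCount r n A : ℝ)) /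
        (Nat.card (Matrix (Fin r) (Fin n) (ZMod 2)) : ℝ)
      = (∏ i ∈ Finset.Icc 1 r, (1 - ((2 : ℝ) ^ i)⁻¹)) * (n.choose r : ℝ) ∧
    (∑ A : Matrix (Fin r) (Fin n) (ZMod 2), (basisCount r n A : ℝ) ^ 2) /
        (Nat.card (Matrix (Fin r) (Fin n) (ZMod 2)) : ℝ)
      - ((∑ A : Matrix (Fin r) (Fin n) (ZMod 2), (basisCount r n A : ℝ)) /
          (Nat.card (Matrix (Fin r) (Fin n) (ZMod 2)) : ℝ)) ^ 2
      ≤ 4 * (((n : ℝ) + (r : ℝ)) / (2 * (n : ℝ))) ^ r *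
        ((∑ A : Matrix (Fin r) (Fin n) (ZMod 2), (basisCount r n A : ℝ)) /
          (Nat.card (Matrix (Fin r) (Fin n) (ZMod 2)) : ℝ)) ^ 2 := by
  have hN : (Nat.card (Matrix (Fin r) (Fin n) (ZMod 2)) : ℝ) ≠ 0 := by
    have : 0 < Nat.card (Matrix (Fin r) (Fin n) (ZMod 2)) := Nat.card_pos
    positivity
  rw [sum_first, sum_second, mul_div_cancel_left₀ _ hN, mul_div_cancel_left₀ _ hN]
  refine ⟨rfl, ?_⟩
  have h := mul_le_mul_of_nonneg_left (double_bound n r h2 (by omega)) (pp_pos r).le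
  linear_combination h
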